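/- For every p = (x₁,x₂,x₃,x₁₂,x₁₃,x₂₃,x₁₂₃) ∈ ℝ⁷ one has the identity det(g₃(p)) + F(p) = G(p)². Consequently, if F(p) = 0 then det(g₃(p)) = G(p)² ≥ 0, and det(g₃(p)) = 0 if and only if G(p) = 0. -/

import Mathlib

noncomputable section

/-- Coordinates on `ℝ⁷` are `p = (x₁,x₂,x₃,x₁₂,x₁₃,x₂₃,x₁₂₃)`, indexed `0,…,6`. -/
abbrev R7 := Fin 7 → ℝ

/-- The symmetric 4×4 matrix `g₃(p)`. -/
def g3Mat (p : R7) : Matrix (Fin 4) (Fin 4) ℝ :=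
  !![1,    p 0,                  p 1,                  p 2;
     p 0,  1,                    2 * p 0 * p 1 - p 3,  2 * p 0 * p 2 - p 4;
     p 1,  2 * p 0 * p 1 - p 3,  1,                    2 * p 1 * p 2 - p 5;
     p 2,  2 * p 0 * p 2 - p 4,  2 * p 1 * p 2 - p 5,  1]

/-- `G = 2x₁x₂x₃ + x₁₂₃ − x₃x₁₂ − x₁x₂₃ − x₂x₁₃`. -/
def G (p : R7) : ℝ :=
  2 * p 0 * p 1 * p 2 + p 6 - p 2 * p 3 - p 0 * p 5 - p 1 * p 4

/-- The Aut(F₃)-invariant polynomial `F`. -/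
def F (p : R7) : ℝ :=
  p 0 ^ 2 + p 1 ^ 2 + p 2 ^ 2 + p 3 ^ 2 + p 4 ^ 2 + p 5 ^ 2 + p 6 ^ 2
    + 4 * p 0 * p 1 * p 2 * p 6
    - 2 * p 0 * p 1 * p 3 - 2 * p 0 * p 2 * p 4 - 2 * p 0 * p 5 * p 6
    - 2 * p 1 * p 2 * p 5 - 2 * p 1 * p 4 * p 6 - 2 * p 2 * p 3 * p 6
    + 2 * p 3 * p 4 * p 5 - 1

theorem stmt16 :
    (∀ p : R7, (g3Mat p).det + F p = (G p) ^ 2) ∧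
    (∀ p : R7, F p = 0 →
      (g3Mat p).det = (G p) ^ 2 ∧ 0 ≤ (g3Mat p).det ∧
      ((g3Mat p).det = 0 ↔ G p = 0)) := by
  have key : ∀ p : R7, (g3Mat p).det + F p = (G p) ^ 2 := by
    intro p
    have hdet : (g3Mat p).det = (G p) ^ 2 - F p := by
      unfold g3Mat F G
      rw [Matrix.det_succ_row_zero]
      simp [Fin.sum_univ_succ, Matrix.det_fin_three, Matrix.submatrix_apply, Fin.succAbove]
      ring
    rw [hdet]
    ring
  refine ⟨key, fun p hF => ?_⟩
  have h : (g3Mat p).det = (G p) ^ 2 := by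
    have := key p
    rw [hF, add_zero] at this
    exact this
  refine ⟨h, ?_, ?_⟩
  · rw [h]
    exact sq_nonneg _
  · rw [h]
    exact pow_eq_zero_iff two_ne_zero

end
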